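/- arXiv:2104.05870 — 2 statements merged into one kernel-verified Lean document; each statement's English description precedes it below -/
import Mathlib

section
/- Let d ≥ 1, R > 0 and Ω = (−R,R)^d. For every β > 1, r > R + 1 and b > R + r there exist numbers λ₀ = λ₀(β, r, R, b, d) > 0 and C = C(r, R, b, d) > 0 such that for every λ > λ₀ and every function u ∈ C²(closure Ω) with u = 0 on ∂Ω and ∂u/∂z = 0 on Γ⁺, one has ∫_Ω e^{2λ((z+r)/b)^β} |Δu|² dx ≥ C λ³ β² (β−1) b^{−3β} (r−R)^{2β} ∫_Ω e^{2λ((z+r)/b)^β} |u|² dx + C λ (β−1) b^{−β} ∫_Ω e^{2λ((z+r)/b)^β} |∇u|² dx. -/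
open MeasureTheory Real

noncomputable section

/-- The open cube `Ω = (-R, R)^d` (here the dimension is `d + 1 ≥ 1`). -/
def Omega (d : ℕ) (R : ℝ) : Set (EuclideanSpace ℝ (Fin (d + 1))) :=
  {x | ∀ i, x i ∈ Set.Ioo (-R) R}

/-- The top face `Γ⁺ = {x ∈ closure Ω : z = R}`, `z` being the last coordinate. -/
def GammaPlus (d : ℕ) (R : ℝ) : Set (EuclideanSpace ℝ (Fin (d + 1))) :=
  {x | x ∈ closure (Omega d R) ∧ x (Fin.last d) = R}

/-- Partial derivative with respect to the last coordinate `z`. -/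
def pz (d : ℕ) (u : EuclideanSpace ℝ (Fin (d + 1)) → ℝ)
    (x : EuclideanSpace ℝ (Fin (d + 1))) : ℝ :=
  fderiv ℝ u x (EuclideanSpace.single (Fin.last d) 1)

/-- The Laplacian `Δu = ∑ i, ∂²u/∂xᵢ²`. -/
def lap (d : ℕ) (u : EuclideanSpace ℝ (Fin (d + 1)) → ℝ)
    (x : EuclideanSpace ℝ (Fin (d + 1))) : ℝ :=
  ∑ i : Fin (d + 1),
    fderiv ℝ (fun y => fderiv ℝ u y (EuclideanSpace.single i 1)) x (EuclideanSpace.single i 1)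

/-- The Carleman weight function `x ↦ exp (2 λ ((z + r)/b)^β)`. -/
def cw (d : ℕ) (lam β r b : ℝ) (x : EuclideanSpace ℝ (Fin (d + 1))) : ℝ :=
  Real.exp (2 * lam * ((x (Fin.last d) + r) / b) ^ β)

/-- Partial derivative with respect to the `j`-th coordinate. -/
def partialDeriv {d : ℕ} (j : Fin (d + 1)) (u : EuclideanSpace ℝ (Fin (d + 1)) → ℝ)
    (x : EuclideanSpace ℝ (Fin (d + 1))) : ℝ :=
  fderiv ℝ u x (EuclideanSpace.single j 1)

/-- The closed cube `[-R, R]^d`. -/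
def closedCube (d : ℕ) (R : ℝ) : Set (EuclideanSpace ℝ (Fin (d + 1))) :=
  {x | ∀ i, x i ∈ Set.Icc (-R) R}

section Cube

variable {d : ℕ} {R : ℝ}

lemma Omega_subset_closedCube : Omega d R ⊆ closedCube d R :=
  fun _ hx i => Set.Ioo_subset_Icc_self (hx i)

lemma isOpen_Omega : IsOpen (Omega d R) := by
  have : Omega d R = ⋂ i, {x | x i ∈ Set.Ioo (-R) R} := by ext; simp [Omega]
  rw [this]
  exact isOpen_iInter_of_finite fun i =>
    isOpen_Ioo.preimage (EuclideanSpace.proj (𝕜 := ℝ) i).continuous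

lemma closedCube_eq_preimage :
    closedCube d R = WithLp.ofLp ⁻¹' Set.Icc (fun _ => -R) (fun _ => R) := by
  ext x
  simp [closedCube, Pi.le_def, forall_and]

lemma isCompact_closedCube : IsCompact (closedCube d R) := by
  rw [closedCube_eq_preimage]
  exact (PiLp.homeomorph 2 (fun _ : Fin (d + 1) => ℝ)).isCompact_preimage.2 isCompact_Icc

lemma closedCube_subset_closure_Omega (hR : 0 < R) : closedCube d R ⊆ closure (Omega d R) := by
  intro x hx
  have h : Filter.Tendsto (fun t : ℝ => t • x) (nhdsWithin 1 (Set.Ioo 0 1)) (nhds x) := by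
    have : Continuous fun t : ℝ => t • x := by fun_prop
    simpa using (this.tendsto 1).mono_left nhdsWithin_le_nhds
  have hne : (nhdsWithin (1 : ℝ) (Set.Ioo 0 1)).NeBot := by
    rw [← mem_closure_iff_nhdsWithin_neBot, closure_Ioo (by norm_num)]
    simp
  refine mem_closure_of_tendsto h ?_
  filter_upwards [self_mem_nhdsWithin] with t ht i
  have h1 := (hx i).1
  have h2 := (hx i).2
  simp only [PiLp.smul_apply, smul_eq_mul, Set.mem_Ioo]
  constructor <;> nlinarith [ht.1, ht.2]

lemma mem_frontier_Omega (hR : 0 < R) {x : EuclideanSpace ℝ (Fin (d + 1))}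
    (hx : x ∈ closedCube d R) {i : Fin (d + 1)} (hi : x i = R ∨ x i = -R) :
    x ∈ frontier (Omega d R) := by
  rw [isOpen_Omega.frontier_eq]
  refine ⟨closedCube_subset_closure_Omega hR hx, fun h => ?_⟩
  have := h i
  rcases hi with hi | hi <;> simp [hi] at this

lemma integrableOn_Omega {f : EuclideanSpace ℝ (Fin (d + 1)) → ℝ}
    (hf : ContinuousOn f (closedCube d R)) : IntegrableOn f (Omega d R) :=
  (hf.integrableOn_compact isCompact_closedCube).mono_set Omega_subset_closedCube

lemma continuousOn_divergence {F : Fin (d + 1) → EuclideanSpace ℝ (Fin (d + 1)) → ℝ}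
    (hF : ∀ j, ∀ x ∈ closedCube d R, ContDiffAt ℝ 1 (F j) x) :
    ContinuousOn (fun x => ∑ j, partialDeriv j (F j) x) (closedCube d R) := by
  refine continuousOn_finsetSum _ fun j _ x hx => ContinuousAt.continuousWithinAt ?_
  have : ContinuousAt (fderiv ℝ (F j)) x :=
    ((hF j x hx).fderiv_right (m := 0) (by norm_num)).continuousAt
  exact this.clm_apply continuousAt_const

/-- The integral over the cube of the divergence of a vector field pointing outwards on the
boundary is nonnegative. -/
lemma integral_divergence_nonneg (hR : 0 < R)
    {F : Fin (d + 1) → EuclideanSpace ℝ (Fin (d + 1)) → ℝ}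
    (hF : ∀ j, ∀ x ∈ closedCube d R, ContDiffAt ℝ 1 (F j) x)
    (htop : ∀ j, ∀ x ∈ closedCube d R, x j = R → 0 ≤ F j x)
    (hbot : ∀ j, ∀ x ∈ closedCube d R, x j = -R → F j x ≤ 0) :
    0 ≤ ∫ x in Omega d R, ∑ j, partialDeriv j (F j) x := by
  let L : (Fin (d + 1) → ℝ) ≃L[ℝ] EuclideanSpace ℝ (Fin (d + 1)) :=
    (PiLp.continuousLinearEquiv 2 ℝ (fun _ : Fin (d + 1) => ℝ)).symm
  let D : EuclideanSpace ℝ (Fin (d + 1)) → ℝ := fun x => ∑ j, partialDeriv j (F j) x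
  have hmem : ∀ y ∈ Set.Icc (fun _ : Fin (d + 1) => -R) (fun _ => R), L y ∈ closedCube d R :=
    fun y hy i => ⟨hy.1 i, hy.2 i⟩
  have hD : ContinuousOn D (closedCube d R) := continuousOn_divergence hF
  have hdiv := integral_divergence_of_hasFDerivAt_off_countable'
    (fun _ : Fin (d + 1) => -R) (fun _ => R) (fun _ => by simp [hR.le])
    (fun j y => F j (L y)) (fun j y => (fderiv ℝ (F j) (L y)).comp (L : _ →L[ℝ] _)) ∅
    Set.countable_empty
    (fun j y hy => ((hF j _ (hmem y hy)).continuousAt.comp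
      L.continuous.continuousAt).continuousWithinAt)
    (fun y hy j => by
      have hy' : L y ∈ closedCube d R :=
        fun i => Set.Ioo_subset_Icc_self (hy.1 i (Set.mem_univ i))
      exact ((hF j _ hy').differentiableAt (by norm_num)).hasFDerivAt.comp y L.hasFDerivAt)
    (by
      refine ContinuousOn.integrableOn_compact isCompact_Icc ?_
      exact hD.comp L.continuous.continuousOn hmem)
  have hvol : ∫ x in Omega d R, D x =
      ∫ y in Set.Icc (fun _ : Fin (d + 1) => -R) (fun _ => R), D (L y) := by
    have h1 := (PiLp.volume_preserving_toLp (Fin (d + 1))).setIntegral_preimage_emb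
      (MeasurableEquiv.toLp 2 (Fin (d + 1) → ℝ)).measurableEmbedding D (Omega d R)
    rw [← h1]
    have h2 : (WithLp.toLp 2 ⁻¹' Omega d R : Set (Fin (d + 1) → ℝ)) =
        Set.pi Set.univ fun _ => Set.Ioo (-R) R := by
      ext y; simp [Omega]
    rw [h2]
    exact setIntegral_congr_set (Measure.univ_pi_Ioo_ae_eq_Icc)
  change 0 ≤ ∫ x in Omega d R, D x
  rw [hvol]
  refine le_of_le_of_eq ?_ hdiv.symm
  refine Finset.sum_nonneg fun j _ => sub_nonneg.2 ?_
  have hins : ∀ c ∈ Set.Icc (-R) R, ∀ y ∈ Set.Icc ((fun _ : Fin (d + 1) => -R) ∘ j.succAbove)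
      ((fun _ => R) ∘ j.succAbove),
      L (j.insertNth c y) ∈ closedCube d R := by
    intro c hc y hy i
    change (j.insertNth c y : Fin (d + 1) → ℝ) i ∈ _
    refine j.succAboveCases ?_ (fun k => ?_) i
    · simpa using hc
    · simpa using ⟨hy.1 k, hy.2 k⟩
  have hval : ∀ (c : ℝ) y, L (j.insertNth c y) j = c := fun c y => by
    change (j.insertNth c y : Fin (d + 1) → ℝ) j = c
    simp
  calc _ ≤ (0 : ℝ) := setIntegral_nonpos measurableSet_Icc fun y hy =>
        hbot j _ (hins _ (by simp [hR.le]) y hy) (hval _ _)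
    _ ≤ _ := setIntegral_nonneg measurableSet_Icc fun y hy =>
        htop j _ (hins _ (by simp [hR.le]) y hy) (hval _ _)

/-- Tangential derivatives vanish on the faces of the cube when the function does. -/
lemma partialDeriv_eq_zero_of_face (hR : 0 < R) {u : EuclideanSpace ℝ (Fin (d + 1)) → ℝ}
    (hu0 : ∀ x ∈ closedCube d R, ∀ i, x i = R ∨ x i = -R → u x = 0)
    {x : EuclideanSpace ℝ (Fin (d + 1))} (hu : DifferentiableAt ℝ u x)
    (hx : x ∈ closedCube d R) {i j : Fin (d + 1)} (hij : j ≠ i) (hi : x i = R ∨ x i = -R) :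
    partialDeriv j u x = 0 := by
  have h1 : HasDerivAt (fun t : ℝ => u (x + t • EuclideanSpace.single j 1))
      (partialDeriv j u x) 0 :=
    hu.hasFDerivAt.hasLineDerivAt (EuclideanSpace.single j 1)
  have hmem : (0 : ℝ) ∈ Set.Icc (-R - x j) (R - x j) :=
    ⟨by linarith [(hx j).1], by linarith [(hx j).2]⟩
  have h2 : HasDerivWithinAt (fun t : ℝ => u (x + t • EuclideanSpace.single j 1))
      0 (Set.Icc (-R - x j) (R - x j)) 0 := by
    have h0 : ∀ t ∈ Set.Icc (-R - x j) (R - x j),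
        u (x + t • EuclideanSpace.single j 1) = 0 := by
      intro t ht
      refine hu0 _ (fun k => ?_) i ?_
      · by_cases hk : k = j
        · subst hk
          simp only [PiLp.add_apply, PiLp.smul_apply, PiLp.single_apply, if_true, smul_eq_mul,
            mul_one]
          exact ⟨by linarith [ht.1], by linarith [ht.2]⟩
        · simpa [hk] using hx k
      · simpa [hij.symm] using hi
    exact (hasDerivWithinAt_const (0 : ℝ) _ (0 : ℝ)).congr h0 (h0 0 hmem)
  exact (uniqueDiffOn_Icc (by linarith) 0 hmem).eq_deriv _ h1.hasDerivWithinAt h2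

end Cube

section Carleman

variable {d : ℕ}

/-- The vector field whose divergence appears in the Carleman estimate for the conjugated
function `w`, with a weight whose derivative is `p` and second derivative is `q`. -/
def carlemanField (lam : ℝ) (p q : ℝ → ℝ) (w : EuclideanSpace ℝ (Fin (d + 1)) → ℝ)
    (j : Fin (d + 1)) (x : EuclideanSpace ℝ (Fin (d + 1))) : ℝ :=
  -4 * lam * (partialDeriv j w x * (p (x (Fin.last d)) * partialDeriv (Fin.last d) w x
      + q (x (Fin.last d)) * w x))
    + (if j = Fin.last d then 1 else 0) *
      (2 * lam * (p (x (Fin.last d)) * ∑ k, partialDeriv k w x ^ 2)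
        - 2 * lam ^ 3 * (p (x (Fin.last d)) ^ 3 * w x ^ 2))

lemma ContDiffAt.partialDeriv {w : EuclideanSpace ℝ (Fin (d + 1)) → ℝ}
    {x : EuclideanSpace ℝ (Fin (d + 1))} (hw : ContDiffAt ℝ 2 w x) (k : Fin (d + 1)) :
    ContDiffAt ℝ 1 (partialDeriv k w) x :=
  (hw.fderiv_right (m := 1) (by norm_num)).clm_apply contDiffAt_const

lemma partialDeriv_comm {w : EuclideanSpace ℝ (Fin (d + 1)) → ℝ}
    {x : EuclideanSpace ℝ (Fin (d + 1))} (hw : ContDiffAt ℝ 2 w x) (j k : Fin (d + 1)) :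
    partialDeriv j (partialDeriv k w) x = partialDeriv k (partialDeriv j w) x := by
  have hd : DifferentiableAt ℝ (fderiv ℝ w) x :=
    (hw.fderiv_right (m := 1) (by norm_num)).differentiableAt (by norm_num)
  have key : ∀ i l : Fin (d + 1), partialDeriv i (partialDeriv l w) x =
      fderiv ℝ (fderiv ℝ w) x (EuclideanSpace.single i 1) (EuclideanSpace.single l 1) := by
    intro i l
    have := hd.hasFDerivAt.clm_apply (hasFDerivAt_const (EuclideanSpace.single l (1 : ℝ)) x)
    change fderiv ℝ (fun y => fderiv ℝ w y (EuclideanSpace.single l 1)) x _ = _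
    rw [this.fderiv]
    simp
  rw [key, key]
  exact (hw.isSymmSndFDerivAt (by simp)) _ _

lemma hasDerivAt_line {f : EuclideanSpace ℝ (Fin (d + 1)) → ℝ}
    {x : EuclideanSpace ℝ (Fin (d + 1))} (hf : DifferentiableAt ℝ f x) (j : Fin (d + 1)) :
    HasDerivAt (fun t : ℝ => f (x + t • EuclideanSpace.single j 1)) (partialDeriv j f x) 0 :=
  hf.hasFDerivAt.hasLineDerivAt (EuclideanSpace.single j 1)

lemma hasDerivAt_line_comp_last {p : ℝ → ℝ} {p' : ℝ}
    {x : EuclideanSpace ℝ (Fin (d + 1))} (hp : HasDerivAt p p' (x (Fin.last d)))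
    (j : Fin (d + 1)) :
    HasDerivAt (fun t : ℝ => p ((x + t • EuclideanSpace.single j (1 : ℝ)) (Fin.last d)))
      ((if j = Fin.last d then 1 else 0) * p') 0 := by
  have h1 : HasDerivAt (fun t : ℝ => x (Fin.last d) + t * (if j = Fin.last d then 1 else 0))
      (if j = Fin.last d then 1 else 0) 0 := by
    simpa using ((hasDerivAt_id (0 : ℝ)).mul_const
      (if j = Fin.last d then (1 : ℝ) else 0)).const_add (x (Fin.last d))
  have h2 : HasDerivAt p p' (x (Fin.last d) + 0 * (if j = Fin.last d then 1 else 0)) := by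
    simpa using hp
  refine ((h2.comp (0 : ℝ) h1).congr_deriv (mul_comm _ _)).congr_of_eventuallyEq
    (Filter.Eventually.of_forall fun t => ?_)
  simp [eq_comm]

lemma contDiffAt_comp_last {p : ℝ → ℝ} {n : WithTop ℕ∞} {x : EuclideanSpace ℝ (Fin (d + 1))}
    (hp : ContDiffAt ℝ n p (x (Fin.last d))) :
    ContDiffAt ℝ n (fun y : EuclideanSpace ℝ (Fin (d + 1)) => p (y (Fin.last d))) x :=
  ContDiffAt.comp x hp (EuclideanSpace.proj (𝕜 := ℝ) (Fin.last d)).contDiff.contDiffAt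

lemma contDiffAt_carlemanField {lam : ℝ} {p q : ℝ → ℝ}
    {w : EuclideanSpace ℝ (Fin (d + 1)) → ℝ} {x : EuclideanSpace ℝ (Fin (d + 1))}
    (hw : ContDiffAt ℝ 2 w x) (hp : ContDiffAt ℝ 1 p (x (Fin.last d)))
    (hq : ContDiffAt ℝ 1 q (x (Fin.last d))) (j : Fin (d + 1)) :
    ContDiffAt ℝ 1 (carlemanField lam p q w j) x := by
  have h1 := hw.partialDeriv
  have h2 := contDiffAt_comp_last hp
  have h3 := contDiffAt_comp_last hq
  have h4 : ContDiffAt ℝ 1 w x := hw.of_le (by norm_num)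
  have h5 : ContDiffAt ℝ 1 (fun y => ∑ k, partialDeriv k w y ^ 2) x :=
    ContDiffAt.sum fun k _ => (h1 k).pow 2
  exact (contDiffAt_const.mul ((h1 j).mul ((h2.mul (h1 _)).add (h3.mul h4)))).add
    (contDiffAt_const.mul ((contDiffAt_const.mul (h2.mul h5)).sub
      (contDiffAt_const.mul ((h2.pow 3).mul (h4.pow 2)))))

lemma partialDeriv_carlemanField {lam s : ℝ} {p q : ℝ → ℝ}
    {w : EuclideanSpace ℝ (Fin (d + 1)) → ℝ} {x : EuclideanSpace ℝ (Fin (d + 1))}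
    (hw : ContDiffAt ℝ 2 w x)
    (hp : HasDerivAt p (q (x (Fin.last d))) (x (Fin.last d)))
    (hq : HasDerivAt q s (x (Fin.last d)))
    (hF : ∀ j, DifferentiableAt ℝ (carlemanField lam p q w j) x) (j : Fin (d + 1)) :
    partialDeriv j (carlemanField lam p q w j) x =
      -4 * lam * (partialDeriv j (partialDeriv j w) x *
          (p (x (Fin.last d)) * partialDeriv (Fin.last d) w x + q (x (Fin.last d)) * w x)
        + p (x (Fin.last d)) * (partialDeriv j w x *
          partialDeriv (Fin.last d) (partialDeriv j w) x)
        + q (x (Fin.last d)) * partialDeriv j w x ^ 2)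
      + (if j = Fin.last d then 1 else 0) *
        (-4 * lam * (partialDeriv j w x * (q (x (Fin.last d)) * partialDeriv (Fin.last d) w x
            + s * w x))
          + 2 * lam * (q (x (Fin.last d)) * ∑ k, partialDeriv k w x ^ 2
            + 2 * p (x (Fin.last d)) *
              ∑ k, partialDeriv k w x * partialDeriv j (partialDeriv k w) x)
          - 2 * lam ^ 3 * (3 * p (x (Fin.last d)) ^ 2 * q (x (Fin.last d)) * w x ^ 2
            + 2 * p (x (Fin.last d)) ^ 3 * w x * partialDeriv j w x)) := by
  have h1 : ∀ k, HasDerivAt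
      (fun t : ℝ => partialDeriv k w (x + t • EuclideanSpace.single j 1))
      (partialDeriv j (partialDeriv k w) x) 0 :=
    fun k => hasDerivAt_line ((hw.partialDeriv k).differentiableAt (by norm_num)) j
  have h2 := hasDerivAt_line (hw.differentiableAt (by norm_num)) j
  have h3 := hasDerivAt_line_comp_last hp j
  have h4 := hasDerivAt_line_comp_last hq j
  have h5 := HasDerivAt.fun_sum (u := Finset.univ) fun k _ => (h1 k).pow 2
  have h6 := (((h1 j).mul ((h3.mul (h1 (Fin.last d))).add (h4.mul h2))).const_mul
      (-4 * lam)).add ((((h3.mul h5).const_mul (2 * lam)).sub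
      (((h3.pow 3).mul (h2.pow 2)).const_mul (2 * lam ^ 3))).const_mul
        (if j = Fin.last d then (1 : ℝ) else 0))
  rw [(hasDerivAt_line (hF j) j).unique h6]
  have hs : ∑ k, ((2 : ℕ) : ℝ) * partialDeriv k w x ^ (2 - 1) * partialDeriv j (partialDeriv k w) x
      = 2 * ∑ k, partialDeriv k w x * partialDeriv j (partialDeriv k w) x := by
    rw [Finset.mul_sum]
    exact Finset.sum_congr rfl fun k _ => by norm_num; ring
  simp only [zero_smul, add_zero, Pi.mul_apply, Pi.add_apply, Pi.pow_apply]
  rw [hs, partialDeriv_comm hw j (Fin.last d)]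
  split_ifs
  · push_cast
    ring
  · push_cast
    ring

/-- Pointwise Carleman inequality for the conjugated function. -/
lemma carleman_pointwise {lam s : ℝ} {p q : ℝ → ℝ}
    {w : EuclideanSpace ℝ (Fin (d + 1)) → ℝ} {x : EuclideanSpace ℝ (Fin (d + 1))}
    (hw : ContDiffAt ℝ 2 w x)
    (hp : HasDerivAt p (q (x (Fin.last d))) (x (Fin.last d)))
    (hq : HasDerivAt q s (x (Fin.last d)))
    (hF : ∀ j, DifferentiableAt ℝ (carlemanField lam p q w j) x)
    (hp0 : p (x (Fin.last d)) ≠ 0) (hlq : 0 ≤ lam * q (x (Fin.last d))) :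
    ∑ j, partialDeriv j (carlemanField lam p q w j) x
      + (2 * lam ^ 3 * p (x (Fin.last d)) ^ 2 * q (x (Fin.last d)) * w x ^ 2
        + 2 * lam * q (x (Fin.last d)) * ∑ k, partialDeriv k w x ^ 2
        - (lam * q (x (Fin.last d)) + s / p (x (Fin.last d))) ^ 2 * w x ^ 2) ≤
      (∑ j, partialDeriv j (partialDeriv j w) x
        - 2 * lam * p (x (Fin.last d)) * partialDeriv (Fin.last d) w x
        + (lam ^ 2 * p (x (Fin.last d)) ^ 2 - lam * q (x (Fin.last d))) * w x) ^ 2 := by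
  simp only [partialDeriv_carlemanField hw hp hq hF, Finset.sum_add_distrib, ← Finset.mul_sum,
    ← Finset.sum_mul, ite_mul, one_mul, zero_mul, Finset.sum_ite_eq', Finset.mem_univ, if_true]
  set P := p (x (Fin.last d))
  set Q := q (x (Fin.last d))
  set W := w x
  set Z := partialDeriv (Fin.last d) w x
  set L := ∑ j, partialDeriv j (partialDeriv j w) x
  set G := ∑ k, partialDeriv k w x ^ 2
  set H := ∑ k, partialDeriv k w x * partialDeriv (Fin.last d) (partialDeriv k w) x
  have h1 : 0 ≤ (L - 2 * lam * P * Z + (lam ^ 2 * P ^ 2 - lam * Q) * W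
      + 2 * lam * (P * Z + Q * W)) ^ 2 := sq_nonneg _
  have h2 : 0 ≤ (2 * lam * P * Z + (lam * Q + s / P) * W) ^ 2 := sq_nonneg _
  have h3 : 0 ≤ lam * Q * Z ^ 2 := mul_nonneg hlq (sq_nonneg _)
  have h4 : P * (s / P) = s := by field_simp
  have h5 : P * (s / P) * (lam * Z * W) = s * (lam * Z * W) := by rw [h4]
  nlinarith [h1, h2, h3, h5]

/-- First derivatives of the conjugated function `exp (λ φ) u`. -/
lemma partialDeriv_exp_mul {lam p : ℝ} {φ : ℝ → ℝ} {u : EuclideanSpace ℝ (Fin (d + 1)) → ℝ}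
    {x : EuclideanSpace ℝ (Fin (d + 1))} (hu : DifferentiableAt ℝ u x)
    (hφ : HasDerivAt φ p (x (Fin.last d))) (j : Fin (d + 1)) :
    partialDeriv j (fun y => Real.exp (lam * φ (y (Fin.last d))) * u y) x =
      Real.exp (lam * φ (x (Fin.last d))) *
        (partialDeriv j u x + (if j = Fin.last d then 1 else 0) * (lam * p * u x)) := by
  have hd : DifferentiableAt ℝ
      (fun y : EuclideanSpace ℝ (Fin (d + 1)) =>
        Real.exp (lam * φ (y (Fin.last d))) * u y) x := by
    have h := hφ.differentiableAt.comp x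
      (EuclideanSpace.proj (𝕜 := ℝ) (Fin.last d)).differentiableAt
    exact (h.const_mul lam).exp.mul hu
  have h1 := (((hasDerivAt_line_comp_last hφ j).const_mul lam).exp).mul (hasDerivAt_line hu j)
  rw [(hasDerivAt_line hd j).unique h1]
  simp only [zero_smul, add_zero]
  ring

/-- Pure second derivatives of the conjugated function `exp (λ φ) u`. -/
lemma partialDeriv_partialDeriv_exp_mul {lam q : ℝ} {φ p : ℝ → ℝ}
    {u : EuclideanSpace ℝ (Fin (d + 1)) → ℝ} {x : EuclideanSpace ℝ (Fin (d + 1))}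
    (hu : ContDiff ℝ 2 u) (hφ : ∀ᶠ t in nhds (x (Fin.last d)), HasDerivAt φ (p t) t)
    (hp : HasDerivAt p q (x (Fin.last d))) (j : Fin (d + 1)) :
    partialDeriv j (partialDeriv j
        fun y => Real.exp (lam * φ (y (Fin.last d))) * u y) x =
      Real.exp (lam * φ (x (Fin.last d))) *
        (partialDeriv j (partialDeriv j u) x + (if j = Fin.last d then 1 else 0) *
          (2 * lam * p (x (Fin.last d)) * partialDeriv j u x
            + (lam * q + lam ^ 2 * p (x (Fin.last d)) ^ 2) * u x)) := by
  have hu1 : Differentiable ℝ u := hu.differentiable (by norm_num)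
  have hu2 : DifferentiableAt ℝ (partialDeriv j u) x :=
    (hu.contDiffAt.partialDeriv j).differentiableAt (by norm_num)
  have hproj : DifferentiableAt ℝ (fun y : EuclideanSpace ℝ (Fin (d + 1)) => y (Fin.last d)) x :=
    (EuclideanSpace.proj (𝕜 := ℝ) (Fin.last d)).differentiableAt
  have hev : (partialDeriv j fun y => Real.exp (lam * φ (y (Fin.last d))) * u y) =ᶠ[nhds x]
      fun y => Real.exp (lam * φ (y (Fin.last d))) *
        (partialDeriv j u y + (if j = Fin.last d then 1 else 0) *
          (lam * p (y (Fin.last d)) * u y)) := by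
    filter_upwards [hproj.continuousAt.eventually hφ] with y hy
    exact partialDeriv_exp_mul (hu1 y) hy j
  have h0 := hφ.self_of_nhds
  have hd : DifferentiableAt ℝ (fun y => Real.exp (lam * φ (y (Fin.last d))) *
        (partialDeriv j u y + (if j = Fin.last d then 1 else 0) *
          (lam * p (y (Fin.last d)) * u y))) x := by
    have h1 : DifferentiableAt ℝ (fun y : EuclideanSpace ℝ (Fin (d + 1)) =>
      φ (y (Fin.last d))) x := h0.differentiableAt.comp x hproj
    have h2 : DifferentiableAt ℝ (fun y : EuclideanSpace ℝ (Fin (d + 1)) =>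
      p (y (Fin.last d))) x := hp.differentiableAt.comp x hproj
    exact (h1.const_mul lam).exp.mul
      (hu2.add (((h2.const_mul lam).mul (hu1 x)).const_mul _))
  have h1 := (((hasDerivAt_line_comp_last h0 j).const_mul lam).exp).mul
    ((hasDerivAt_line hu2 j).add ((((hasDerivAt_line_comp_last hp j).const_mul lam).mul
      (hasDerivAt_line (hu1 x) j)).const_mul (if j = Fin.last d then (1 : ℝ) else 0)))
  have h2 : partialDeriv j (partialDeriv j
      fun y => Real.exp (lam * φ (y (Fin.last d))) * u y) x = _ :=
    (congrArg (fun T : _ →L[ℝ] ℝ => T (EuclideanSpace.single j 1)) hev.fderiv_eq).trans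
      ((hasDerivAt_line hd j).unique h1)
  rw [h2]
  simp only [zero_smul, add_zero, Pi.add_apply, Pi.mul_apply]
  split_ifs <;> ring

lemma norm_gradient_sq (u : EuclideanSpace ℝ (Fin (d + 1)) → ℝ)
    (x : EuclideanSpace ℝ (Fin (d + 1))) :
    ‖gradient u x‖ ^ 2 = ∑ k, partialDeriv k u x ^ 2 := by
  rw [EuclideanSpace.norm_sq_eq]
  refine Finset.sum_congr rfl fun k _ => ?_
  have : partialDeriv k u x = gradient u x k := by
    rw [partialDeriv, ← toDual_gradient, InnerProductSpace.toDual_apply_apply,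
      EuclideanSpace.inner_single_right]
    simp
  rw [this, Real.norm_eq_abs, sq_abs]

/-- First derivative of the weight exponent `((t + r) / b) ^ β`. -/
def phaseDeriv (β r b t : ℝ) : ℝ := β * ((t + r) / b) ^ β / (t + r)

/-- Second derivative of the weight exponent `((t + r) / b) ^ β`. -/
def phaseDeriv2 (β r b t : ℝ) : ℝ := β * (β - 1) * ((t + r) / b) ^ β / (t + r) ^ 2

lemma hasDerivAt_phase {β r b t : ℝ} (hb : 0 < b) (ht : 0 < t + r) :
    HasDerivAt (fun t => ((t + r) / b) ^ β) (phaseDeriv β r b t) t := by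
  have h := (((hasDerivAt_id t).add_const r).div_const b).rpow_const (p := β)
    (Or.inl (by simpa using (div_pos ht hb).ne'))
  refine h.congr_deriv ?_
  simp only [id, phaseDeriv]
  rw [Real.rpow_sub_one (div_pos ht hb).ne']
  field_simp

lemma hasDerivAt_phaseDeriv {β r b t : ℝ} (hb : 0 < b) (ht : 0 < t + r) :
    HasDerivAt (phaseDeriv β r b) (phaseDeriv2 β r b t) t := by
  have h := ((hasDerivAt_phase (β := β) hb ht).const_mul β).div
    ((hasDerivAt_id t).add_const r) ht.ne'
  refine h.congr_deriv ?_
  simp only [id, phaseDeriv, phaseDeriv2]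
  field_simp

lemma hasDerivAt_phaseDeriv2 {β r b t : ℝ} (hb : 0 < b) (ht : 0 < t + r) :
    HasDerivAt (phaseDeriv2 β r b)
      (β * (β - 1) * (β - 2) * ((t + r) / b) ^ β / (t + r) ^ 3) t := by
  have h := ((hasDerivAt_phase (β := β) hb ht).const_mul (β * (β - 1))).div
    (((hasDerivAt_id t).add_const r).pow 2) (pow_ne_zero 2 ht.ne')
  refine h.congr_deriv ?_
  simp only [id, phaseDeriv, Pi.pow_apply]
  field_simp
  push_cast
  ring

lemma contDiffAt_phase {β r b t : ℝ} {n : WithTop ℕ∞} (hb : 0 < b) (ht : 0 < t + r) :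
    ContDiffAt ℝ n (fun t => ((t + r) / b) ^ β) t :=
  ((contDiffAt_id.add contDiffAt_const).div_const b).rpow_const_of_ne (div_pos ht hb).ne'

lemma contDiffAt_phaseDeriv {β r b t : ℝ} {n : WithTop ℕ∞} (hb : 0 < b) (ht : 0 < t + r) :
    ContDiffAt ℝ n (phaseDeriv β r b) t :=
  (contDiffAt_const.mul (contDiffAt_phase hb ht)).div (contDiffAt_id.add contDiffAt_const) ht.ne'

lemma contDiffAt_phaseDeriv2 {β r b t : ℝ} {n : WithTop ℕ∞} (hb : 0 < b) (ht : 0 < t + r) :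
    ContDiffAt ℝ n (phaseDeriv2 β r b) t :=
  (contDiffAt_const.mul (contDiffAt_phase hb ht)).div
    ((contDiffAt_id.add contDiffAt_const).pow 2) (pow_ne_zero 2 ht.ne')

/-- For large `λ` the lower order terms are absorbed by the main term. -/
lemma phase_absorb {lam β r b t : ℝ} (hb : 0 < b) (hβ : 1 < β) (ht : 1 ≤ t + r)
    (hlam : 8 * (β + 2) * b ^ β / β < lam) :
    (lam * phaseDeriv2 β r b t
      + β * (β - 1) * (β - 2) * ((t + r) / b) ^ β / (t + r) ^ 3 / phaseDeriv β r b t) ^ 2 ≤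
      1 / 2 * lam ^ 3 * phaseDeriv β r b t ^ 2 * phaseDeriv2 β r b t := by
  have hT : 0 < t + r := by linarith
  have hβ0 : 0 < β := by linarith
  have hbβ : 0 < b ^ β := Real.rpow_pos_of_pos hb β
  have hA : 0 < ((t + r) / b) ^ β := Real.rpow_pos_of_pos (div_pos hT hb) β
  have hX : 8 * (β + 2) ≤ lam * phaseDeriv β r b t := by
    have h1 : t + r ≤ (t + r) ^ β := Real.self_le_rpow_of_one_le ht hβ.le
    have h2 : 8 * (β + 2) * b ^ β ≤ lam * β := by
      rw [div_lt_iff₀ hβ0] at hlam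
      exact hlam.le
    rw [phaseDeriv, Real.div_rpow hT.le hb.le]
    rw [show lam * (β * ((t + r) ^ β / b ^ β) / (t + r)) =
      (lam * β * (t + r) ^ β) / (b ^ β * (t + r)) by field_simp]
    rw [le_div_iff₀ (by positivity)]
    calc 8 * (β + 2) * (b ^ β * (t + r)) = 8 * (β + 2) * b ^ β * (t + r) := by ring
      _ ≤ lam * β * (t + r) ^ β := by
        apply mul_le_mul h2 h1 hT.le
        exact le_trans (by positivity) h2
  have e1 : lam * phaseDeriv2 β r b t = (β - 1) / (t + r) * (lam * phaseDeriv β r b t) := by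
    rw [phaseDeriv, phaseDeriv2]; field_simp
  have e2 : β * (β - 1) * (β - 2) * ((t + r) / b) ^ β / (t + r) ^ 3 / phaseDeriv β r b t =
      (β - 1) / (t + r) * ((β - 2) / (t + r)) := by
    rw [phaseDeriv]; field_simp
  have e3 : 1 / 2 * lam ^ 3 * phaseDeriv β r b t ^ 2 * phaseDeriv2 β r b t =
      1 / 2 * (lam * phaseDeriv β r b t) ^ 2 * (lam * phaseDeriv2 β r b t) := by ring
  rw [e3, e1, e2]
  set X := lam * phaseDeriv β r b t
  set a := (β - 1) / (t + r) with ha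
  set c := (β - 2) / (t + r) with hc
  have ha0 : 0 ≤ a := div_nonneg (by linarith) hT.le
  have ha1 : a ≤ β := by
    rw [ha, div_le_iff₀ hT]; nlinarith
  have hc1 : c ≤ X := by
    refine le_trans ?_ hX
    rw [hc, div_le_iff₀ hT]; nlinarith
  have hc2 : -X ≤ c := by
    refine le_trans (neg_le_neg hX) ?_
    rw [hc, le_div_iff₀ hT]; nlinarith
  have h1 : (X + c) ^ 2 ≤ (2 * X) ^ 2 := by
    apply sq_le_sq' <;> linarith
  calc (a * X + a * c) ^ 2 = a * (a * (X + c) ^ 2) := by ring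
    _ ≤ a * (a * (2 * X) ^ 2) := by gcongr
    _ = a * X ^ 2 * (4 * a) := by ring
    _ ≤ a * X ^ 2 * (1 / 2 * X) := by
      apply mul_le_mul_of_nonneg_left _ (by positivity)
      linarith
    _ = _ := by ring

lemma phase_lower_zero {lam β r b t R : ℝ} (hb : 0 < b) (hβ : 1 < β) (hr : 1 ≤ r - R)
    (ht : t ∈ Set.Icc (-R) R) (hlam : 0 < lam) :
    1 / (2 * (r + R) ^ 4) * lam ^ 3 * β ^ 2 * (β - 1) * b ^ (-(3 * β)) * (-R + r) ^ (2 * β) ≤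
      1 / 2 * lam ^ 3 * phaseDeriv β r b t ^ 2 * phaseDeriv2 β r b t := by
  have hT1 : 1 ≤ t + r := by linarith [ht.1]
  have hT : 0 < t + r := by linarith
  have hT2 : t + r ≤ r + R := by linarith [ht.2]
  have hbβ : 0 < b ^ β := Real.rpow_pos_of_pos hb β
  have e1 : b ^ (-(3 * β)) = 1 / (b ^ β) ^ 3 := by
    rw [Real.rpow_neg hb.le, mul_comm, Real.rpow_mul hb.le]
    norm_cast
    simp
  have e2 : (-R + r) ^ (2 * β) = ((-R + r) ^ β) ^ 2 := by
    rw [mul_comm, Real.rpow_mul (by linarith)]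
    norm_cast
  have h1 : (-R + r) ^ β ≤ (t + r) ^ β :=
    Real.rpow_le_rpow (by linarith) (by linarith [ht.1]) (by linarith)
  have h0 : 0 ≤ (-R + r) ^ β := Real.rpow_nonneg (by linarith) _
  have h2 : 1 ≤ (t + r) ^ β := Real.one_le_rpow hT1 (by linarith)
  rw [e1, e2, phaseDeriv, phaseDeriv2, Real.div_rpow hT.le hb.le]
  set A := (t + r) ^ β
  have h3 : ((-R + r) ^ β) ^ 2 ≤ β * A ^ 3 := by
    calc ((-R + r) ^ β) ^ 2 ≤ A ^ 2 := by gcongr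
      _ ≤ A ^ 3 := pow_le_pow_right₀ h2 (by norm_num)
      _ ≤ β * A ^ 3 := le_mul_of_one_le_left (by positivity) hβ.le
  have hβ1 : 0 < β - 1 := by linarith
  have hβ0 : 0 < β := by linarith
  calc 1 / (2 * (r + R) ^ 4) * lam ^ 3 * β ^ 2 * (β - 1) * (1 / (b ^ β) ^ 3) * ((-R + r) ^ β) ^ 2
      ≤ 1 / (2 * (t + r) ^ 4) * lam ^ 3 * β ^ 2 * (β - 1) * (1 / (b ^ β) ^ 3) * (β * A ^ 3) := by
        gcongr
    _ = _ := by field_simp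

lemma phase_lower_one {lam β r b t R : ℝ} (hb : 0 < b) (hβ : 1 < β) (hr : 1 ≤ r - R)
    (ht : t ∈ Set.Icc (-R) R) (hlam : 0 < lam) :
    1 / (2 * (r + R) ^ 4) * lam * (β - 1) * b ^ (-β) ≤ 1 / 2 * lam * phaseDeriv2 β r b t := by
  have hT1 : 1 ≤ t + r := by linarith [ht.1]
  have hT : 0 < t + r := by linarith
  have hT2 : t + r ≤ r + R := by linarith [ht.2]
  have hbβ : 0 < b ^ β := Real.rpow_pos_of_pos hb β
  have h2 : 1 ≤ (t + r) ^ β := Real.one_le_rpow hT1 (by linarith)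
  rw [phaseDeriv2, Real.div_rpow hT.le hb.le, Real.rpow_neg hb.le]
  set A := (t + r) ^ β
  have hβ1 : 0 < β - 1 := by linarith
  have hT4 : (t + r) ^ 2 ≤ (r + R) ^ 4 := by
    calc (t + r) ^ 2 ≤ (t + r) ^ 4 := pow_le_pow_right₀ hT1 (by norm_num)
      _ ≤ (r + R) ^ 4 := by gcongr
  have h3 : 1 ≤ β * A := by nlinarith
  calc 1 / (2 * (r + R) ^ 4) * lam * (β - 1) * (b ^ β)⁻¹
      ≤ 1 / (2 * (t + r) ^ 2) * lam * (β - 1) * (b ^ β)⁻¹ := by gcongr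
    _ ≤ 1 / (2 * (t + r) ^ 2) * lam * (β - 1) * (b ^ β)⁻¹ * (β * A) :=
        le_mul_of_one_le_right (by positivity) h3
    _ = _ := by field_simp

end Carleman

/-- Carleman estimate. -/
theorem carleman_estimate (d : ℕ) (R : ℝ) (hR : 0 < R) (r b : ℝ)
    (hr : R + 1 < r) (hb : R + r < b) :
    ∃ C : ℝ, 0 < C ∧ ∀ β : ℝ, 1 < β → ∃ lam0 : ℝ, 0 < lam0 ∧
      ∀ lam : ℝ, lam0 < lam →
        ∀ u : EuclideanSpace ℝ (Fin (d + 1)) → ℝ, ContDiff ℝ 2 u →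
          (∀ x ∈ frontier (Omega d R), u x = 0) →
          (∀ x ∈ GammaPlus d R, pz d u x = 0) →
          (∫ x in Omega d R, cw d lam β r b x * (lap d u x) ^ 2) ≥
            C * lam ^ 3 * β ^ 2 * (β - 1) * b ^ (-(3 * β)) * (-R + r) ^ (2 * β) *
              (∫ x in Omega d R, cw d lam β r b x * (u x) ^ 2) +
            C * lam * (β - 1) * b ^ (-β) *
              (∫ x in Omega d R, cw d lam β r b x * ‖gradient u x‖ ^ 2) := by
  have hb0 : 0 < b := by linarith
  have hrR : 0 < r + R := by linarith
  have hrR1 : 1 ≤ r - R := by linarith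
  refine ⟨1 / (2 * (r + R) ^ 4), by positivity, fun β hβ =>
    ⟨8 * (β + 2) * b ^ β / β, by positivity, fun lam hlam u hu hu0 hu1 => ?_⟩⟩
  have hlam0 : 0 < lam := lt_trans (by positivity) hlam
  have hcube0 : ∀ x ∈ closedCube d R, ∀ i, x i = R ∨ x i = -R → u x = 0 :=
    fun x hx i hi => hu0 x (mem_frontier_Omega hR hx hi)
  have hpos : ∀ x ∈ closedCube d R, 0 < x (Fin.last d) + r := fun x hx => by
    linarith [(hx (Fin.last d)).1]
  set φ : ℝ → ℝ := fun t => ((t + r) / b) ^ β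
  set p := phaseDeriv β r b with hp
  set q := phaseDeriv2 β r b with hq
  set w : EuclideanSpace ℝ (Fin (d + 1)) → ℝ :=
    fun y => Real.exp (lam * φ (y (Fin.last d))) * u y with hw
  have hw2 : ∀ x ∈ closedCube d R, ContDiffAt ℝ 2 w x := fun x hx =>
    (contDiffAt_const.mul (contDiffAt_comp_last (contDiffAt_phase hb0 (hpos x hx)))).exp.mul
      hu.contDiffAt
  have hF : ∀ j, ∀ x ∈ closedCube d R, ContDiffAt ℝ 1 (carlemanField lam p q w j) x :=
    fun j x hx => contDiffAt_carlemanField (hw2 x hx) (contDiffAt_phaseDeriv hb0 (hpos x hx))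
      (contDiffAt_phaseDeriv2 hb0 (hpos x hx)) j
  have hw0 : ∀ x ∈ closedCube d R, ∀ i, x i = R ∨ x i = -R → w x = 0 := fun x hx i hi => by
    simp [hw, hcube0 x hx i hi]
  have hwt : ∀ x ∈ closedCube d R, ∀ i j, j ≠ i → x i = R ∨ x i = -R → partialDeriv j w x = 0 :=
    fun x hx i j hij hi => partialDeriv_eq_zero_of_face hR hw0
      ((hw2 x hx).differentiableAt (by norm_num)) hx hij hi
  have hFlat : ∀ j, j ≠ Fin.last d → ∀ x ∈ closedCube d R, x j = R ∨ x j = -R →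
      carlemanField lam p q w j x = 0 := fun j hj x hx hxj => by
    simp [carlemanField, hj, hw0 x hx j hxj, hwt x hx j _ hj.symm hxj]
  have hdiv := integral_divergence_nonneg hR hF
    (fun j x hx hxj => by
      by_cases hj : j = Fin.last d
      · subst hj
        have hz : partialDeriv (Fin.last d) w x = 0 := by
          have h1 : partialDeriv (Fin.last d) u x = 0 :=
            hu1 x ⟨closedCube_subset_closure_Omega hR hx, hxj⟩
          rw [hw, partialDeriv_exp_mul (hu.differentiable (by norm_num) x)
            (hasDerivAt_phase hb0 (hpos x hx)), h1, hcube0 x hx _ (Or.inl hxj)]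
          simp
        have hk : ∀ k, partialDeriv k w x = 0 := fun k => by
          by_cases hk : k = Fin.last d
          · rw [hk, hz]
          · exact hwt x hx _ k hk (Or.inl hxj)
        simp [carlemanField, hk, hw0 x hx _ (Or.inl hxj)]
      · exact (hFlat j hj x hx (Or.inl hxj)).ge)
    (fun j x hx hxj => by
      by_cases hj : j = Fin.last d
      · subst hj
        have hsum : ∑ k, partialDeriv k w x ^ 2 = partialDeriv (Fin.last d) w x ^ 2 :=
          Finset.sum_eq_single _ (fun k _ hk => by rw [hwt x hx _ k hk (Or.inr hxj)]; simp)
            (by simp)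
        have hp0 : 0 ≤ p (x (Fin.last d)) := by
          have := hpos x hx
          rw [hp, phaseDeriv]
          positivity
        simp only [carlemanField, hw0 x hx _ (Or.inr hxj), hsum, if_true]
        nlinarith [mul_nonneg (mul_nonneg hlam0.le hp0) (sq_nonneg (partialDeriv (Fin.last d) w x))]
      · exact (hFlat j hj x hx (Or.inr hxj)).le)
  have hpt : ∀ x ∈ Omega d R,
      ∑ j, partialDeriv j (carlemanField lam p q w j) x
        + (1 / (2 * (r + R) ^ 4) * lam ^ 3 * β ^ 2 * (β - 1) * b ^ (-(3 * β)) *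
            (-R + r) ^ (2 * β) * (cw d lam β r b x * u x ^ 2)
          + 1 / (2 * (r + R) ^ 4) * lam * (β - 1) * b ^ (-β) *
            (cw d lam β r b x * ‖gradient u x‖ ^ 2)) ≤ cw d lam β r b x * lap d u x ^ 2 := by
    intro x hx
    have hxc := Omega_subset_closedCube hx
    have ht := hxc (Fin.last d)
    have hT := hpos x hxc
    have hβ1 : 0 < β - 1 := by linarith
    have hp0 : 0 < p (x (Fin.last d)) := by rw [hp, phaseDeriv]; positivity
    have hq0 : 0 < q (x (Fin.last d)) := by rw [hq, phaseDeriv2]; positivity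
    have hev : ∀ᶠ t in nhds (x (Fin.last d)), HasDerivAt φ (p t) t := by
      filter_upwards [lt_mem_nhds (show -r < x (Fin.last d) by linarith)] with t ht
      exact hasDerivAt_phase hb0 (by linarith)
    have key := carleman_pointwise (lam := lam) (hw2 x hxc) (hasDerivAt_phaseDeriv hb0 hT)
      (hasDerivAt_phaseDeriv2 hb0 hT)
      (fun j => (hF j x hxc).differentiableAt (by norm_num)) hp0.ne' (by positivity)
    have habs := phase_absorb (r := r) (t := x (Fin.last d)) hb0 hβ (by linarith [ht.1]) hlam
    have hlow0 := phase_lower_zero hb0 hβ hrR1 ht hlam0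
    have hlow1 := phase_lower_one hb0 hβ hrR1 ht hlam0
    have hpd : ∀ k, partialDeriv k w x = Real.exp (lam * φ (x (Fin.last d))) *
        (partialDeriv k u x + (if k = Fin.last d then 1 else 0) *
          (lam * p (x (Fin.last d)) * u x)) := fun k =>
      partialDeriv_exp_mul (hu.differentiable (by norm_num) x) hev.self_of_nhds k
    have hlap : ∑ j, partialDeriv j (partialDeriv j w) x
        - 2 * lam * p (x (Fin.last d)) * partialDeriv (Fin.last d) w x
        + (lam ^ 2 * p (x (Fin.last d)) ^ 2 - lam * q (x (Fin.last d))) * w x =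
        Real.exp (lam * φ (x (Fin.last d))) * lap d u x := by
      have hl : lap d u x = ∑ j, partialDeriv j (partialDeriv j u) x := rfl
      rw [hpd, hw]
      simp only [partialDeriv_partialDeriv_exp_mul hu hev (hasDerivAt_phaseDeriv hb0 hT),
        ← Finset.mul_sum, Finset.sum_add_distrib, ite_mul, one_mul, zero_mul, Finset.sum_ite_eq',
        Finset.mem_univ, if_true, hl]
      ring
    have hcw : cw d lam β r b x = Real.exp (lam * φ (x (Fin.last d))) ^ 2 := by
      rw [cw, ← Real.exp_nat_mul]
      congr 1
      push_cast
      ring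
    have hgrad : Real.exp (lam * φ (x (Fin.last d))) ^ 2 * ‖gradient u x‖ ^ 2 ≤
        2 * ∑ k, partialDeriv k w x ^ 2 + 2 * (lam * p (x (Fin.last d))) ^ 2 * w x ^ 2 := by
      have h1 : 2 * (lam * p (x (Fin.last d))) ^ 2 * w x ^ 2 = ∑ k : Fin (d + 1),
          (if k = Fin.last d then 1 else 0) * (2 * (lam * p (x (Fin.last d))) ^ 2 * w x ^ 2) := by
        simp
      rw [h1, norm_gradient_sq, Finset.mul_sum, Finset.mul_sum, ← Finset.sum_add_distrib]
      refine Finset.sum_le_sum fun k _ => ?_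
      rw [hpd k, hw]
      split_ifs
      · nlinarith [sq_nonneg (Real.exp (lam * φ (x (Fin.last d))) *
          (partialDeriv k u x + 2 * (lam * p (x (Fin.last d)) * u x)))]
      · nlinarith [sq_nonneg (Real.exp (lam * φ (x (Fin.last d))) * partialDeriv k u x)]
    rw [← hp, ← hq] at key habs hlow0
    rw [← hq] at hlow1
    rw [hlap, mul_pow _ (lap d u x), ← hcw] at key
    refine le_trans ?_ key
    rw [← hcw] at hgrad
    have hwx : w x ^ 2 = cw d lam β r b x * u x ^ 2 := by rw [hcw, hw]; ring
    have hcw0 : 0 ≤ cw d lam β r b x := (Real.exp_pos _).le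
    have m1 := mul_le_mul_of_nonneg_right habs (sq_nonneg (w x))
    have m2 := mul_le_mul_of_nonneg_right hlow0 (sq_nonneg (w x))
    have m3 := mul_le_mul_of_nonneg_right hlow1
      (mul_nonneg hcw0 (sq_nonneg ‖gradient u x‖))
    have m4 := mul_le_mul_of_nonneg_left hgrad
      (show 0 ≤ 1 / 2 * lam * q (x (Fin.last d)) by positivity)
    have m5 : 0 ≤ lam * q (x (Fin.last d)) * ∑ k, partialDeriv k w x ^ 2 :=
      mul_nonneg (by positivity) (Finset.sum_nonneg fun k _ => sq_nonneg _)
    rw [← hwx]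
    linarith
  have hcw : ContinuousOn (cw d lam β r b) (closedCube d R) := fun x hx =>
    ((contDiffAt_const.mul (contDiffAt_comp_last
      (contDiffAt_phase (n := 0) hb0 (hpos x hx)))).exp).continuousAt.continuousWithinAt
  have hpu : ∀ k, ContDiff ℝ 1 (partialDeriv k u) := fun k =>
    contDiff_iff_contDiffAt.2 fun x => hu.contDiffAt.partialDeriv k
  have hI0 : IntegrableOn (fun x => cw d lam β r b x * u x ^ 2) (Omega d R) :=
    integrableOn_Omega (hcw.mul (hu.continuous.pow 2).continuousOn)
  have hI1 : IntegrableOn (fun x => cw d lam β r b x * ‖gradient u x‖ ^ 2) (Omega d R) := by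
    simp only [norm_gradient_sq]
    exact integrableOn_Omega (hcw.mul
      (continuous_finsetSum _ fun k _ => (hpu k).continuous.pow 2).continuousOn)
  have hI2 : IntegrableOn (fun x => cw d lam β r b x * lap d u x ^ 2) (Omega d R) := by
    refine integrableOn_Omega (hcw.mul (Continuous.pow ?_ 2).continuousOn)
    exact continuous_finsetSum _ fun k _ =>
      ((hpu k).continuous_fderiv (by norm_num)).clm_apply continuous_const
  have hI3 : IntegrableOn (fun x => ∑ j, partialDeriv j (carlemanField lam p q w j) x)
      (Omega d R) := integrableOn_Omega (continuousOn_divergence hF)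
  have hI4 := (hI0.const_mul (1 / (2 * (r + R) ^ 4) * lam ^ 3 * β ^ 2 * (β - 1) *
    b ^ (-(3 * β)) * (-R + r) ^ (2 * β))).add
      (hI1.const_mul (1 / (2 * (r + R) ^ 4) * lam * (β - 1) * b ^ (-β)))
  have hmono := setIntegral_mono_on (hI3.add hI4) hI2 isOpen_Omega.measurableSet hpt
  rw [integral_add' hI3 hI4, integral_add' (hI0.const_mul _) (hI1.const_mul _),
    integral_const_mul, integral_const_mul] at hmono
  linarith
end
end

section
/- Let d ≥ 1, R > 0, β > 1, r > R + 1 and b > R + r. There exist λ₀ ≥ 1, depending only on β, r, R, b, and a constant C₁ > 0, depending only on r, R, b, d, such that for every λ > λ₀ and every v ∈ C¹(closure Ω) with v = 0 on ∂Ω, one has −λβ ∫_Ω b^{−β} (z+r)^{β−2} (λβ b^{−β} (z+r)^β − (β−1)) ∂_z(v²) dx ≥ C₁ λ² β² (β−1) b^{−2β} ∫_Ω (z+r)^{2β} v² dx. -/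
open MeasureTheory Real

noncomputable section

/-- Integration by parts on a box against a weight depending only on the `k`-th coordinate,
without boundary terms. -/
theorem setIntegral_Icc_mul_fderiv_single {n : ℕ} {a b : Fin (n + 1) → ℝ} (hab : a ≤ b)
    (k : Fin (n + 1)) {w w' : ℝ → ℝ} {u : (Fin (n + 1) → ℝ) → ℝ}
    (hw : ∀ t ∈ Set.Icc (a k) (b k), HasDerivAt w (w' t) t)
    (hw' : ContinuousOn w' (Set.Icc (a k) (b k))) (hu : ContDiff ℝ 1 u)
    (hu0 : ∀ x ∈ Set.Icc a b, x k = a k ∨ x k = b k → u x = 0) :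
    ∫ x in Set.Icc a b, w (x k) * fderiv ℝ u x (Pi.single k 1) =
      -∫ x in Set.Icc a b, w' (x k) * u x := by
  have hmem : ∀ x ∈ Set.Icc a b, x k ∈ Set.Icc (a k) (b k) := fun x hx => ⟨hx.1 k, hx.2 k⟩
  have hwc : ContinuousOn w (Set.Icc (a k) (b k)) := fun t ht =>
    (hw t ht).continuousAt.continuousWithinAt
  have hwk : ContinuousOn (fun x : Fin (n + 1) → ℝ => w (x k)) (Set.Icc a b) :=
    hwc.comp (continuous_apply k).continuousOn hmem
  have hwk' : ContinuousOn (fun x : Fin (n + 1) → ℝ => w' (x k)) (Set.Icc a b) :=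
    hw'.comp (continuous_apply k).continuousOn hmem
  have hdu : Continuous fun x => fderiv ℝ u x (Pi.single k 1) :=
    (hu.continuous_fderiv one_ne_zero).clm_apply continuous_const
  have hi₁ : IntegrableOn (fun x => w (x k) * fderiv ℝ u x (Pi.single k 1)) (Set.Icc a b) :=
    (hwk.mul hdu.continuousOn).integrableOn_compact isCompact_Icc
  have hi₂ : IntegrableOn (fun x => w' (x k) * u x) (Set.Icc a b) :=
    (hwk'.mul hu.continuous.continuousOn).integrableOn_compact isCompact_Icc
  let f : Fin (n + 1) → (Fin (n + 1) → ℝ) → ℝ := fun i x => if i = k then w (x k) * u x else 0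
  let f' : Fin (n + 1) → (Fin (n + 1) → ℝ) → (Fin (n + 1) → ℝ) →L[ℝ] ℝ := fun i x =>
    if i = k then
      w (x k) • fderiv ℝ u x + u x • (w' (x k) • ContinuousLinearMap.proj (R := ℝ) k)
    else 0
  have hsum : ∀ x, ∑ i, f' i x (Pi.single i 1) =
      w (x k) * fderiv ℝ u x (Pi.single k 1) + w' (x k) * u x := by
    intro x
    rw [Finset.sum_eq_single k (fun i _ hik => by simp [f', hik]) (by simp)]
    simp [f', mul_comm]
  have key := integral_divergence_of_hasFDerivAt_off_countable' a b hab f f' ∅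
    Set.countable_empty ?_ ?_ ?_
  · simp only [hsum] at key
    rw [integral_add hi₁ hi₂] at key
    have hfaces : ∀ i : Fin (n + 1), ∀ c, (c = a i ∨ c = b i) →
        ∫ x in Set.Icc (a ∘ Fin.succAbove i) (b ∘ Fin.succAbove i), f i (i.insertNth c x) = 0 := by
      intro i c hc
      refine setIntegral_eq_zero_of_forall_eq_zero fun x hx => ?_
      by_cases hik : i = k
      · subst hik
        have hci : c ∈ Set.Icc (a i) (b i) := by
          rcases hc with rfl | rfl
          · exact ⟨le_rfl, hab i⟩
          · exact ⟨hab i, le_rfl⟩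
        have hz : u (i.insertNth c x) = 0 :=
          hu0 _ (Fin.insertNth_mem_Icc.2 ⟨hci, hx⟩) (by simpa using hc)
        simp [f, hz]
      · simp [f, hik]
    rw [Finset.sum_eq_zero fun i _ => by
      rw [hfaces i _ (Or.inr rfl), hfaces i _ (Or.inl rfl), sub_zero]] at key
    linarith
  · intro i
    by_cases hik : i = k
    · simp only [f, hik, if_true]
      exact hwk.mul hu.continuous.continuousOn
    · simpa [f, hik] using continuousOn_const
  · rintro x ⟨hx, -⟩ i
    by_cases hik : i = k
    · have hxk : x k ∈ Set.Icc (a k) (b k) := Set.Ioo_subset_Icc_self (hx k (Set.mem_univ k))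
      have h₁ : HasFDerivAt (fun x : Fin (n + 1) → ℝ => w (x k))
          (w' (x k) • ContinuousLinearMap.proj (R := ℝ) k) x :=
        (hw _ hxk).comp_hasFDerivAt x (hasFDerivAt_apply k x)
      simp only [f, f', hik, if_true]
      exact h₁.mul ((hu.differentiable one_ne_zero).differentiableAt (x := x)).hasFDerivAt
    · simpa [f, f', hik] using hasFDerivAt_const (0 : ℝ) x
  · simp only [hsum]
    exact hi₁.add hi₂

theorem toLp_mem_Omega {d : ℕ} {R : ℝ} {y : Fin (d + 1) → ℝ} :
    WithLp.toLp 2 y ∈ Omega d R ↔ y ∈ Set.univ.pi fun _ => Set.Ioo (-R) R := by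
  simp [Omega, Set.mem_pi]

theorem toLp_mem_frontier_Omega {d : ℕ} {R : ℝ} (hR : 0 < R) {y : Fin (d + 1) → ℝ}
    (hy : y ∈ Set.Icc (fun _ => -R) fun _ => R) {k : Fin (d + 1)} (hk : y k = -R ∨ y k = R) :
    WithLp.toLp 2 y ∈ frontier (Omega d R) := by
  have hO : Omega d R = PiLp.homeomorph 2 (fun _ : Fin (d + 1) => ℝ) ⁻¹'
      Set.univ.pi fun _ => Set.Ioo (-R) R := by
    ext x
    exact toLp_mem_Omega (y := WithLp.ofLp x)
  rw [hO, ← Homeomorph.preimage_frontier]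
  change y ∈ frontier _
  rw [(isOpen_set_pi Set.finite_univ fun _ _ => isOpen_Ioo).frontier_eq, closure_pi_set,
    closure_Ioo (by linarith), Set.pi_univ_Icc]
  refine ⟨hy, fun h => ?_⟩
  have := h k (Set.mem_univ k)
  rcases hk with hk | hk <;> simp [hk] at this

theorem setIntegral_Omega {d : ℕ} {R : ℝ} (F : EuclideanSpace ℝ (Fin (d + 1)) → ℝ) :
    ∫ x in Omega d R, F x =
      ∫ y in Set.Icc (fun _ : Fin (d + 1) => -R) (fun _ => R), F (WithLp.toLp 2 y) := by
  rw [← (PiLp.volume_preserving_toLp (Fin (d + 1))).setIntegral_preimage_emb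
    (MeasurableEquiv.toLp 2 (Fin (d + 1) → ℝ)).measurableEmbedding]
  have hO : WithLp.toLp 2 ⁻¹' Omega d R = Set.univ.pi fun _ => Set.Ioo (-R) R := by
    ext y
    exact toLp_mem_Omega
  rw [hO]
  exact setIntegral_congr_set Measure.univ_pi_Ioo_ae_eq_Icc

theorem pz_toLp {d : ℕ} {u : EuclideanSpace ℝ (Fin (d + 1)) → ℝ} (hu : Differentiable ℝ u)
    (y : Fin (d + 1) → ℝ) :
    pz d u (WithLp.toLp 2 y) =
      fderiv ℝ (fun y => u (WithLp.toLp 2 y)) y (Pi.single (Fin.last d) 1) := by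
  have h := (hu (WithLp.toLp 2 y)).hasFDerivAt.comp y
    (PiLp.continuousLinearEquiv 2 ℝ (fun _ : Fin (d + 1) => ℝ)).symm.hasFDerivAt
  have h' : HasFDerivAt (fun y => u (WithLp.toLp 2 y)) _ y := h
  rw [h'.fderiv]
  rfl

/-- The weight in `I₁` as a function of `s = z + r`. -/
def weight (b β lam s : ℝ) : ℝ :=
  b ^ (-β) * s ^ (β - 2) * (lam * β * b ^ (-β) * s ^ β - (β - 1))

/-- The derivative of `weight b β lam` on the positive half-line. -/
def weightDeriv (b β lam s : ℝ) : ℝ :=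
  lam * β * b ^ (-(2 * β)) * (2 * β - 2) * s ^ (2 * β - 3) -
    (β - 1) * (β - 2) * b ^ (-β) * s ^ (β - 3)

theorem hasDerivAt_weight {b s : ℝ} (β lam : ℝ) (hb : 0 < b) (hs : 0 < s) :
    HasDerivAt (weight b β lam) (weightDeriv b β lam s) s := by
  have h₁ := (hasDerivAt_rpow_const (p := β - 2) (Or.inl hs.ne')).const_mul (b ^ (-β))
  have h₂ := ((hasDerivAt_rpow_const (p := β) (Or.inl hs.ne')).const_mul
    (lam * β * b ^ (-β))).sub_const (β - 1)
  refine (h₁.mul h₂).congr_deriv ?_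
  have e₁ : b ^ (-(2 * β)) = b ^ (-β) * b ^ (-β) := by rw [← rpow_add hb]; ring_nf
  have e₂ : s ^ (2 * β - 3) = s ^ (β - 3) * s ^ β := by rw [← rpow_add hs]; ring_nf
  have e₃ : s ^ (β - 2) * s ^ (β - 1) = s ^ (β - 3) * s ^ β := by
    rw [← rpow_add hs, ← rpow_add hs]; ring_nf
  have e₄ : s ^ (β - 2 - 1) = s ^ (β - 3) := by ring_nf
  rw [weightDeriv, e₁, e₂, e₄]
  linear_combination (b ^ (-β) * b ^ (-β) * lam * β * β) * e₃

theorem le_mul_weightDeriv {b β lam s : ℝ} (hβ : 1 < β) (hlam : b ^ β ≤ lam) (hs : 1 ≤ s)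
    (hsb : s ≤ b) :
    1 / b ^ 3 * lam ^ 2 * β ^ 2 * (β - 1) * b ^ (-(2 * β)) * s ^ (2 * β) ≤
      lam * β * weightDeriv b β lam s := by
  have hs0 : 0 < s := by linarith
  have hb : 0 < b := by linarith
  have hB : 0 < b ^ (-β) := rpow_pos_of_pos hb _
  have hS : 0 < s ^ (β - 3) := rpow_pos_of_pos hs0 _
  have hSβ : 1 ≤ s ^ β := one_le_rpow hs (by linarith)
  have hlam0 : 0 < lam := (rpow_pos_of_pos hb β).trans_le hlam
  have e₁ : b ^ (-(2 * β)) = b ^ (-β) * b ^ (-β) := by rw [← rpow_add hb]; ring_nf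
  have e₂ : s ^ (2 * β - 3) = s ^ (β - 3) * s ^ β := by rw [← rpow_add hs0]; ring_nf
  have e₃ : s ^ (2 * β) = s ^ (β - 3) * s ^ β * s ^ 3 := by
    rw [← rpow_natCast, ← rpow_add hs0, ← rpow_add hs0]; push_cast; ring_nf
  have hBb : 1 ≤ lam * b ^ (-β) := by
    calc (1 : ℝ) = b ^ β * b ^ (-β) := by rw [← rpow_add hb]; simp
      _ ≤ lam * b ^ (-β) := by gcongr
  have hq : 1 / b ^ 3 * s ^ 3 ≤ 1 := by
    rw [one_div_mul_eq_div, div_le_one (by positivity)]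
    gcongr
  have hX : 1 ≤ lam * b ^ (-β) * s ^ β := by nlinarith
  have hβ2 : β - 2 ≤ β * (lam * b ^ (-β) * s ^ β) := by nlinarith
  have hc : 0 ≤ lam * β * (β - 1) * b ^ (-β) * s ^ (β - 3) := by
    have : 0 < β - 1 := by linarith
    positivity
  have hY : 1 / b ^ 3 * s ^ 3 * (β * (lam * b ^ (-β) * s ^ β)) ≤
      β * (lam * b ^ (-β) * s ^ β) := mul_le_of_le_one_left (by positivity) hq
  have := mul_le_mul_of_nonneg_left (add_le_add hY hβ2) hc
  rw [weightDeriv, e₁, e₂, e₃]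
  linarith

theorem continuousOn_weightDeriv (b β lam : ℝ) :
    ContinuousOn (weightDeriv b β lam) (Set.Ioi 0) := by
  have h : ∀ p : ℝ, ContinuousOn (fun s : ℝ => s ^ p) (Set.Ioi 0) := fun p s hs =>
    (continuousAt_rpow_const s p (Or.inl (ne_of_gt hs))).continuousWithinAt
  exact ((h (2 * β - 3)).const_mul (lam * β * b ^ (-(2 * β)) * (2 * β - 2))).sub
    ((h (β - 3)).const_mul ((β - 1) * (β - 2) * b ^ (-β)))

/-- lower bound for the term `I₁` in the Carleman estimate. -/
theorem I1_lower_bound (d : ℕ) (R : ℝ) (hR : 0 < R) (r b : ℝ)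
    (hr : R + 1 < r) (hb : R + r < b) :
    ∃ C₁ : ℝ, 0 < C₁ ∧ ∀ β : ℝ, 1 < β → ∃ lam0 : ℝ, 1 ≤ lam0 ∧
      ∀ lam : ℝ, lam0 < lam →
        ∀ v : EuclideanSpace ℝ (Fin (d + 1)) → ℝ, ContDiff ℝ 1 v →
          (∀ x ∈ frontier (Omega d R), v x = 0) →
          (-(lam * β) * ∫ x in Omega d R,
              b ^ (-β) * (x (Fin.last d) + r) ^ (β - 2) *
                (lam * β * b ^ (-β) * (x (Fin.last d) + r) ^ β - (β - 1)) *
                pz d (fun y => (v y) ^ 2) x) ≥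
            C₁ * lam ^ 2 * β ^ 2 * (β - 1) * b ^ (-(2 * β)) *
              (∫ x in Omega d R, (x (Fin.last d) + r) ^ (2 * β) * (v x) ^ 2) := by
  have hb0 : 0 < b := by linarith
  refine ⟨1 / b ^ 3, by positivity, fun β hβ => ⟨max 1 (b ^ β), le_max_left _ _,
    fun lam hlam v hv hv0 => ?_⟩⟩
  have hlamb : b ^ β ≤ lam := (le_max_right _ _).trans hlam.le
  set k := Fin.last d
  set Q : Set (Fin (d + 1) → ℝ) := Set.Icc (fun _ => -R) fun _ => R
  have hu : ContDiff ℝ 1 fun x => v x ^ 2 := hv.pow 2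
  have hu' : ContDiff ℝ 1 fun y : Fin (d + 1) → ℝ => v (WithLp.toLp 2 y) ^ 2 :=
    hu.comp (PiLp.continuousLinearEquiv 2 ℝ (fun _ : Fin (d + 1) => ℝ)).symm.contDiff
  have hQ : ∀ y ∈ Q, 1 ≤ y k + r ∧ y k + r ≤ b := fun y hy => by
    have h₁ : -R ≤ y k := hy.1 k
    have h₂ : y k ≤ R := hy.2 k
    constructor <;> linarith
  have hibp := setIntegral_Icc_mul_fderiv_single (a := fun _ => -R) (b := fun _ => R)
    (fun _ => by linarith : (fun _ : Fin (d + 1) => -R) ≤ fun _ => R) k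
    (w := fun t => weight b β lam (t + r)) (w' := fun t => weightDeriv b β lam (t + r))
    (fun t ht => (hasDerivAt_weight β lam hb0 (by linarith [ht.1])).comp_add_const t r)
    ((continuousOn_weightDeriv b β lam).comp (by fun_prop)
      fun t ht => Set.mem_Ioi.2 (by linarith [ht.1]))
    hu' fun y hy hyk => by rw [hv0 _ (toLp_mem_frontier_Omega hR hy hyk)]; simp
  have hcont : ContinuousOn (fun y : Fin (d + 1) → ℝ =>
      weightDeriv b β lam (y k + r) * v (WithLp.toLp 2 y) ^ 2) Q :=
    ((continuousOn_weightDeriv b β lam).comp (by fun_prop)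
      fun y hy => Set.mem_Ioi.2 (by linarith [hQ y hy])).mul hu'.continuous.continuousOn
  have hcont' : ContinuousOn (fun y : Fin (d + 1) → ℝ =>
      (y k + r) ^ (2 * β) * v (WithLp.toLp 2 y) ^ 2) Q := by
    refine ContinuousOn.mul (ContinuousOn.rpow_const (by fun_prop) fun y hy => Or.inl ?_)
      hu'.continuous.continuousOn
    linarith [hQ y hy]
  rw [setIntegral_Omega, setIntegral_Omega]
  simp only [pz_toLp (hu.differentiable one_ne_zero)]
  change _ * (∫ y in Q, weight b β lam (y k + r) * _) ≥ _
  rw [hibp, neg_mul_neg, ge_iff_le, ← integral_const_mul, ← integral_const_mul]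
  refine setIntegral_mono_on ((hcont'.integrableOn_compact isCompact_Icc).const_mul _)
    ((hcont.integrableOn_compact isCompact_Icc).const_mul _) measurableSet_Icc fun y hy => ?_
  rw [← mul_assoc, ← mul_assoc]
  exact mul_le_mul_of_nonneg_right (le_mul_weightDeriv hβ hlamb (hQ y hy).1 (hQ y hy).2)
    (sq_nonneg _)
end
end
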